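/- There does not exist a polynomial modulus of uniform continuity of F on [0,1]: there is no polynomial P with natural number coefficients such that for all n ∈ ℕ and all x, y ∈ [0,1], |x − y| ≤ 2^{−P(n)} implies |F(x) − F(y)| ≤ 2^{−n}. -/

import Mathlib

open scoped BigOperators

/-- The piecewise linear "step" function `β_{p,q}` on `[0,1]`. -/
noncomputable def beta (p q : ℕ) (x : ℝ) : ℝ :=
  if x ≤ (p : ℝ) / q then 0
  else if x ≤ ((p : ℝ) + (2:ℝ) ^ (-(q:ℤ))) / q then (2:ℝ) ^ q * (x - (p : ℝ) / q)
  else 1 / q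

/-- `α_q(x) = ∑_{p=0}^{q-1} β_{p,q}(x)`. -/
noncomputable def alpha (q : ℕ) (x : ℝ) : ℝ := ∑ p ∈ Finset.range q, beta p q x

/-- `F(x) = ∑_{q=1}^∞ (1/q²)·α_q(x)`. -/
noncomputable def F (x : ℝ) : ℝ := ∑' q : ℕ, (1 / ((q:ℝ) + 1) ^ 2) * alpha (q + 1) x

open Filter Topology

theorem tendsto_polynomial_eval_div_two_pow (P : Polynomial ℕ) :
    Tendsto (fun n : ℕ => ((P.eval n : ℕ) : ℝ) / 2 ^ n) atTop (𝓝 0) := by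
  induction P using Polynomial.induction_on' with
  | add p q hp hq =>
    have h := hp.add hq
    rw [add_zero] at h
    refine h.congr fun n => ?_
    rw [Polynomial.eval_add, Nat.cast_add, add_div]
  | monomial k a =>
    have h := (tendsto_pow_const_div_const_pow_of_one_lt k (one_lt_two (α := ℝ))).const_mul (a : ℝ)
    rw [mul_zero] at h
    refine h.congr fun n => ?_
    rw [Polynomial.eval_monomial, Nat.cast_mul, Nat.cast_pow, mul_div_assoc]

theorem exists_polynomial_eval_lt_two_pow (P : Polynomial ℕ) : ∃ n : ℕ, P.eval n < 2 ^ n := by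
  obtain ⟨n, hn⟩ :=
    ((tendsto_polynomial_eval_div_two_pow P).eventually (gt_mem_nhds one_pos)).exists
  rw [div_lt_one (by positivity)] at hn
  exact ⟨n, by exact_mod_cast hn⟩

theorem beta_nonneg (p q : ℕ) (x : ℝ) : 0 ≤ beta p q x := by
  unfold beta
  split_ifs with h
  · exact le_rfl
  · exact mul_nonneg (by positivity) (by linarith)
  · positivity

theorem beta_le (p q : ℕ) (x : ℝ) : beta p q x ≤ 1 / q := by
  unfold beta
  split_ifs with h h'
  · positivity
  · have hx : x - (p : ℝ) / q ≤ (2:ℝ) ^ (-(q:ℤ)) / q := by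
      rw [add_div] at h'
      linarith
    calc (2:ℝ) ^ q * (x - (p : ℝ) / q) ≤ (2:ℝ) ^ q * ((2:ℝ) ^ (-(q:ℤ)) / q) := by gcongr
      _ = 1 / q := by
        rw [zpow_neg, zpow_natCast, ← mul_div_assoc, mul_inv_cancel₀ (by positivity)]
  · exact le_rfl

theorem beta_zero_right (p q : ℕ) : beta p q 0 = 0 :=
  if_pos (by positivity)

theorem beta_zero_left_two_pow_inv_div {q : ℕ} (hq : 0 < q) :
    beta 0 q (((2:ℝ) ^ q)⁻¹ / q) = 1 / q := by
  have hq' : (0:ℝ) < q := by exact_mod_cast hq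
  have h : 0 < ((2:ℝ) ^ q)⁻¹ / q := by positivity
  unfold beta
  rw [if_neg (by simpa using h), if_pos (by simp)]
  simp only [Nat.cast_zero, zero_div, sub_zero]
  rw [← mul_div_assoc, mul_inv_cancel₀ (by positivity)]

theorem alpha_nonneg (q : ℕ) (x : ℝ) : 0 ≤ alpha q x :=
  Finset.sum_nonneg fun p _ => beta_nonneg p q x

theorem alpha_le_one (q : ℕ) (x : ℝ) : alpha q x ≤ 1 := by
  calc alpha q x ≤ ∑ _p ∈ Finset.range q, (1 / q : ℝ) :=
        Finset.sum_le_sum fun p _ => beta_le p q x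
    _ = q / q := by simp [div_eq_mul_inv]
    _ ≤ 1 := div_self_le_one _

theorem F_zero : F 0 = 0 := by
  simp [F, alpha, beta_zero_right]

theorem summable_F (x : ℝ) :
    Summable fun q : ℕ => (1 / ((q:ℝ) + 1) ^ 2) * alpha (q + 1) x := by
  have h : Summable fun q : ℕ => 1 / ((q:ℝ) + 1) ^ 2 := by
    have := (summable_nat_add_iff 1).mpr (Real.summable_one_div_nat_pow.mpr one_lt_two)
    simpa using this
  refine h.of_nonneg_of_le (fun q => mul_nonneg (by positivity) (alpha_nonneg _ _)) fun q => ?_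
  exact mul_le_of_le_one_right (by positivity) (alpha_le_one _ _)

theorem one_div_pow_three_le_F (q : ℕ) :
    1 / ((q:ℝ) + 1) ^ 3 ≤ F (((2:ℝ) ^ (q + 1))⁻¹ / ((q + 1 : ℕ) : ℝ)) := by
  set y := ((2:ℝ) ^ (q + 1))⁻¹ / ((q + 1 : ℕ) : ℝ)
  have h₁ : 1 / ((q + 1 : ℕ) : ℝ) ≤ alpha (q + 1) y := by
    rw [← beta_zero_left_two_pow_inv_div q.succ_pos]
    exact Finset.single_le_sum (f := fun p => beta p (q + 1) y)
      (fun p _ => beta_nonneg p (q + 1) y) (Finset.mem_range.mpr q.succ_pos)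
  calc 1 / ((q:ℝ) + 1) ^ 3 = (1 / ((q:ℝ) + 1) ^ 2) * (1 / ((q + 1 : ℕ) : ℝ)) := by
        push_cast
        field_simp
    _ ≤ (1 / ((q:ℝ) + 1) ^ 2) * alpha (q + 1) y := by gcongr
    _ ≤ F y := (summable_F y).le_tsum q fun k _ =>
        mul_nonneg (by positivity) (alpha_nonneg _ _)

theorem no_polynomial_modulus :
    ¬ ∃ P : Polynomial ℕ, ∀ n : ℕ, ∀ x ∈ Set.Icc (0:ℝ) 1, ∀ y ∈ Set.Icc (0:ℝ) 1,
      |x - y| ≤ ((2:ℝ) ^ (P.eval n))⁻¹ → |F x - F y| ≤ ((2:ℝ) ^ n)⁻¹ := by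
  rintro ⟨P, hP⟩
  obtain ⟨n, hn⟩ := exists_polynomial_eval_lt_two_pow ((P + 1) ^ 3)
  rw [Polynomial.eval_pow, Polynomial.eval_add, Polynomial.eval_one] at hn
  set q := P.eval n
  set y := ((2:ℝ) ^ (q + 1))⁻¹ / ((q + 1 : ℕ) : ℝ)
  have hy0 : 0 ≤ y := by positivity
  have hyq : y ≤ ((2:ℝ) ^ q)⁻¹ :=
    calc y ≤ ((2:ℝ) ^ (q + 1))⁻¹ :=
          div_le_self (by positivity) (by exact_mod_cast Nat.le_add_left 1 q)
      _ ≤ ((2:ℝ) ^ q)⁻¹ := by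
          gcongr
          · exact one_le_two
          · exact q.le_succ
  have hy1 : y ≤ 1 := hyq.trans (inv_le_one_of_one_le₀ (one_le_pow₀ one_le_two))
  have h := hP n y ⟨hy0, hy1⟩ 0 ⟨le_rfl, zero_le_one⟩ (by rwa [sub_zero, abs_of_nonneg hy0])
  rw [F_zero, sub_zero] at h
  have hF : 1 / ((q:ℝ) + 1) ^ 3 ≤ ((2:ℝ) ^ n)⁻¹ :=
    (one_div_pow_three_le_F q).trans ((le_abs_self _).trans h)
  rw [one_div, inv_le_inv₀ (by positivity) (by positivity)] at hF
  exact absurd hn (not_lt.mpr (by exact_mod_cast hF))
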